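/- Let φ be a Sturmian coloring of a d-regular tree. There exists K ∈ [0,∞] such that S_n = A_n = C_n holds if and only if −1 ≤ n < K. Consequently, if K is finite, then either A_K = S_K or B_K = S_K. -/

import Mathlib

open scoped Classical

noncomputable section

namespace Sturm

variable {V α : Type}

/-- `G` is a `d`-regular tree. -/
structure IsRegularTree (G : SimpleGraph V) (d : ℕ) : Prop where
  isTree : G.IsTree
  regular : ∀ v : V, (G.neighborSet v).ncard = d

/-- Color-preserving isomorphism of the `n`-balls centered at `x` and `y`,
sending center to center. -/
def BallEquiv (G : SimpleGraph V) (φ : V → α) (n : ℕ) (x y : V) : Prop :=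
  ∃ f : {z : V // G.dist x z ≤ n} ≃ {z : V // G.dist y z ≤ n},
    (∀ u v : {z : V // G.dist x z ≤ n}, G.Adj u.1 v.1 ↔ G.Adj (f u).1 (f v).1) ∧
    (∀ u : {z : V // G.dist x z ≤ n}, φ (f u).1 = φ u.1) ∧
    ((f ⟨x, by rw [SimpleGraph.dist_self]; exact Nat.zero_le n⟩).1 = y)

/-- The class of the `n`-ball at `x`, viewed as the set of all centers of equivalent balls. -/
def ballClass (G : SimpleGraph V) (φ : V → α) (n : ℕ) (x : V) : Set V :=
  {y | BallEquiv G φ n x y}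

/-- The set `B_n(φ)` of classes of `n`-balls occurring in `(T, φ)`. -/
def ballClasses (G : SimpleGraph V) (φ : V → α) (n : ℕ) : Set (Set V) :=
  {C | ∃ x, C = ballClass G φ n x}

/-- A coloring is Sturmian if its factor complexity is `n + 2`. -/
def IsSturmian (G : SimpleGraph V) (φ : V → α) : Prop :=
  ∀ n, (ballClasses G φ n).ncard = n + 2

/-- `x` is the center of a special `n`-ball. -/
def IsSpecialVert (G : SimpleGraph V) (φ : V → α) (n : ℕ) (x : V) : Prop :=
  ∃ y, BallEquiv G φ n x y ∧ ¬ BallEquiv G φ (n + 1) x y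

/-- `S` is a special class of `n`-balls: the restriction of two distinct classes of
`(n+1)`-balls. -/
def IsSpecialClass (G : SimpleGraph V) (φ : V → α) (n : ℕ) (S : Set V) : Prop :=
  ∃ x, S = ballClass G φ n x ∧ IsSpecialVert G φ n x

/-- The class `D` is always adjacent to the class `E`. -/
def AlwaysAdjTo (G : SimpleGraph V) (D E : Set V) : Prop :=
  ∀ x ∈ D, ∃ y, G.Adj x y ∧ y ∈ E

/-- The classes `D` and `E` are (always) adjacent. -/
def AlwaysAdj (G : SimpleGraph V) (D E : Set V) : Prop :=
  AlwaysAdjTo G D E ∧ AlwaysAdjTo G E D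

/-- The classes `D` and `E` can be adjacent. -/
def CanAdj (G : SimpleGraph V) (D E : Set V) : Prop :=
  ∃ x ∈ D, ∃ y ∈ E, G.Adj x y

/-- The number of neighbors of `x` lying in (i.e. being centers of balls of class) `E`. -/
def nbrCount (G : SimpleGraph V) (x : V) (E : Set V) : ℕ :=
  (G.neighborSet x ∩ E).ncard

/-- The data of the labels `S_n, C_n, A_n, B_n` for a Sturmian coloring, normalized as in
the paper: `S_0 = A_0 = [a]`, `B_0 = [b]`, `A_{n+1}` (resp. `B_{n+1}`) is always adjacent
to `A_n` (resp. `B_n`), and `A_{n+1}, B_{n+1}` are the two distinct extensions of `S_n`. -/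
structure Labeling (G : SimpleGraph V) (φ : V → α) (a b : α) where
  S : ℕ → Set V
  C : ℕ → Set V
  A : ℕ → Set V
  B : ℕ → Set V
  S_special : ∀ n, IsSpecialClass G φ n (S n)
  C_central : ∀ n, ∃ x, IsSpecialVert G φ (n + 1) x ∧ S (n + 1) = ballClass G φ (n + 1) x ∧
      C n = ballClass G φ n x
  A0_eq_S0 : A 0 = S 0
  A0_col : ∃ x, φ x = a ∧ A 0 = ballClass G φ 0 x
  B0_col : ∃ x, φ x = b ∧ B 0 = ballClass G φ 0 x
  A_ext : ∀ n, ∃ x, IsSpecialVert G φ n x ∧ S n = ballClass G φ n x ∧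
      A (n + 1) = ballClass G φ (n + 1) x
  B_ext : ∀ n, ∃ x, IsSpecialVert G φ n x ∧ S n = ballClass G φ n x ∧
      B (n + 1) = ballClass G φ (n + 1) x
  AB_ne : ∀ n, A (n + 1) ≠ B (n + 1)
  A_adj : ∀ n, AlwaysAdjTo G (A (n + 1)) (A n)
  B_adj : ∀ n, AlwaysAdjTo G (B (n + 1)) (B n)

/-- A cycle (of length `≥ 3`, with pairwise distinct vertices) in the graph `G_n` of
classes of `n`-balls, where classes are joined when they can be adjacent. -/
def IsCycleIn (G : SimpleGraph V) (φ : V → α) (n k : ℕ) (c : ℕ → Set V) : Prop :=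
  3 ≤ k ∧ (∀ i < k, c i ∈ ballClasses G φ n) ∧
    (∀ i < k, CanAdj G (c i) (c ((i + 1) % k))) ∧
    (∀ i < k, ∀ j < k, c i = c j → i = j)

/-- The graph `G_n` contains a cycle. -/
def HasCycle (G : SimpleGraph V) (φ : V → α) (n : ℕ) : Prop :=
  ∃ k c, IsCycleIn G φ n k c

/-! ## Edge-indexed colored graphs -/

/-- An edge-indexed graph, with vertices colored by `α` and labeled by classes
(sets of vertices of the underlying tree `V`). Index `0` means "no edge". -/
structure EIG (V α : Type) where
  Vert : Type
  idx : Vert → Vert → ℕ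
  col : Vert → α
  lab : Vert → Set V

/-- Isomorphism of colored edge-indexed graphs. -/
structure EIGIso (X Y : EIG V α) where
  e : X.Vert ≃ Y.Vert
  idx_eq : ∀ u v, Y.idx (e u) (e v) = X.idx u v
  col_eq : ∀ u, Y.col (e u) = X.col u

/-- The index `i_A(D, E)` (resp. `i_B`, `i`) at the level of classes: the number of
neighbors, in class `E`, of a representative center of `D`; when `D` is the special
class `Sp`, the representative is taken with extension of class `Ext`. -/
def classIdx (G : SimpleGraph V) (Sp Ext : Set V) (D E : Set V) : ℕ :=
  if D = Sp then (if h : Ext.Nonempty then nbrCount G h.some E else 0)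
  else (if h : D.Nonempty then nbrCount G h.some E else 0)

/-- The classes of `n`-balls joined to `Sp` by a path of edges of positive `J`-index. -/
def reachSet (G : SimpleGraph V) (φ : V → α) (n : ℕ) (Sp : Set V)
    (J : Set V → Set V → ℕ) : Set (Set V) :=
  {D | ∃ k, ∃ c : ℕ → Set V, c 0 = Sp ∧ c k = D ∧ (∀ i ≤ k, c i ∈ ballClasses G φ n) ∧
    ∀ i < k, 0 < J (c i) (c (i + 1)) ∨ 0 < J (c (i + 1)) (c i)}

/-- Color of a class: the color of (the center of) any of its representatives. -/
def colOf [Nonempty V] (φ : V → α) (D : Set V) : α :=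
  if h : D.Nonempty then φ h.some else φ (Classical.arbitrary V)

/-- The edge-indexed graph `G^A_n` (when `Ext = A_{n+1}`) resp. `G^B_n`. -/
def sideEIG [Nonempty V] (G : SimpleGraph V) (φ : V → α) (n : ℕ) (Sp Ext : Set V) :
    EIG V α where
  Vert := {D : Set V // D ∈ reachSet G φ n Sp (classIdx G Sp Ext)}
  idx := fun D E => classIdx G Sp Ext D.1 E.1
  col := fun D => colOf φ D.1
  lab := fun D => D.1

variable {G : SimpleGraph V} {φ : V → α} {a b : α}

/-- The edge-indexed graph `G^A_n`. -/
def GAeig [Nonempty V] (L : Labeling G φ a b) (n : ℕ) : EIG V α :=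
  sideEIG G φ n (L.S n) (L.A (n + 1))

/-- The edge-indexed graph `G^B_n`. -/
def GBeig [Nonempty V] (L : Labeling G φ a b) (n : ℕ) : EIG V α :=
  sideEIG G φ n (L.S n) (L.B (n + 1))

/-- Vertex set of `G^A_n`. -/
def VGAset (L : Labeling G φ a b) (n : ℕ) : Set (Set V) :=
  reachSet G φ n (L.S n) (classIdx G (L.S n) (L.A (n + 1)))

/-- Vertex set of `G^B_n`. -/
def VGBset (L : Labeling G φ a b) (n : ℕ) : Set (Set V) :=
  reachSet G φ n (L.S n) (classIdx G (L.S n) (L.B (n + 1)))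

/-- `G^A_n` or `G^B_n`, selected by a letter (`true = A`, `false = B`). -/
def GsideEIG [Nonempty V] (L : Labeling G φ a b) (n : ℕ) : Bool → EIG V α
  | true => GAeig L n
  | false => GBeig L n

/-- Vertex set of `G^A_n` or `G^B_n`, selected by a letter. -/
def VGside (L : Labeling G φ a b) (n : ℕ) : Bool → Set (Set V)
  | true => VGAset L n
  | false => VGBset L n

/-- A single vertex with a loop of index `d` (the graph `G^A_{-1} = G^B_{-1} = F^._{-1}`). -/
def baseEIG (V : Type) (x : α) (d : ℕ) : EIG V α where
  Vert := PUnit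
  idx := fun _ _ => d
  col := fun _ => x
  lab := fun _ => Set.univ

/-- `GAx L d (n+1) = G^A_n`, and `GAx L d 0 = G^A_{-1}`. -/
def GAx [Nonempty V] (L : Labeling G φ a b) (d : ℕ) : ℕ → EIG V α
  | 0 => baseEIG V a d
  | n + 1 => GAeig L n

/-- `GBx L d (n+1) = G^B_n`, and `GBx L d 0 = G^B_{-1}`. -/
def GBx [Nonempty V] (L : Labeling G φ a b) (d : ℕ) : ℕ → EIG V α
  | 0 => baseEIG V b d
  | n + 1 => GBeig L n

/-- `Cx L (n+1) = C_n`, and `Cx L 0 = C_{-1}` (the class of the empty ball). -/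
def Cx (L : Labeling G φ a b) : ℕ → Set V
  | 0 => Set.univ
  | n + 1 => L.C n

/-! ## Concatenations -/

/-- The `(i)`-concatenation of two edge-indexed graphs at the end vertices `v, v'`
(which are identified). -/
def concatI (X Y : EIG V α) (v : X.Vert) (v' : Y.Vert) (i : ℕ) : EIG V α where
  Vert := X.Vert ⊕ {w : Y.Vert // w ≠ v'}
  idx := fun p q =>
    match p, q with
    | Sum.inl u, Sum.inl w =>
        if u = v ∧ w ≠ v then (if X.idx u w = 0 then 0 else i) else X.idx u w
    | Sum.inl u, Sum.inr w => if u = v then Y.idx v' w.1 - i else 0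
    | Sum.inr w, Sum.inl u => if u = v then Y.idx w.1 v' else 0
    | Sum.inr w, Sum.inr w2 => Y.idx w.1 w2.1
  col := Sum.elim X.col (fun w => Y.col w.1)
  lab := Sum.elim X.lab (fun w => Y.lab w.1)

/-- The `(i,j)`-concatenation of two edge-indexed graphs at the end vertices `v, v'`
(which stay distinct, joined by a new edge of indices `i`, `j`). -/
def concatIJ (X Y : EIG V α) (v : X.Vert) (v' : Y.Vert) (i j : ℕ) : EIG V α where
  Vert := X.Vert ⊕ Y.Vert
  idx := fun p q =>
    match p, q with
    | Sum.inl u, Sum.inl w => if u = v ∧ w = v then X.idx v v - i else X.idx u w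
    | Sum.inl u, Sum.inr w => if u = v ∧ w = v' then i else 0
    | Sum.inr w, Sum.inl u => if w = v' ∧ u = v then j else 0
    | Sum.inr u, Sum.inr w => if u = v' ∧ w = v' then Y.idx v' v' - j else Y.idx u w
  col := Sum.elim X.col Y.col
  lab := Sum.elim X.lab Y.lab

/-- `Z` is a concatenation ((i)- or (i,j)-) of `X` and `Y` at `(vX, vY)`. -/
def IsConcatOfAt (Z X Y : EIG V α) (vX : X.Vert) (vY : Y.Vert) : Prop :=
  (∃ i, 1 ≤ i ∧ Nonempty (EIGIso Z (concatI X Y vX vY i))) ∨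
  (∃ i j, 1 ≤ i ∧ 1 ≤ j ∧ Nonempty (EIGIso Z (concatIJ X Y vX vY i j)))

/-! ## Paths, distance, degree in edge-indexed graphs -/

/-- Adjacency (by an edge of positive index, in one of the two orientations). -/
def EIGAdj (X : EIG V α) (u w : X.Vert) : Prop :=
  u ≠ w ∧ (0 < X.idx u w ∨ 0 < X.idx w u)

/-- There is a path of length `L` from `u` to `w`. -/
def EIGReach (X : EIG V α) (u w : X.Vert) (L : ℕ) : Prop :=
  ∃ c : ℕ → X.Vert, c 0 = u ∧ c L = w ∧ ∀ i < L, EIGAdj X (c i) (c (i + 1))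

/-- Graph distance in an edge-indexed graph. -/
def EIGDist (X : EIG V α) (u w : X.Vert) : ℕ :=
  sInf {L | EIGReach X u w L}

/-- `u` has degree one: there is exactly one vertex adjacent to it. -/
def EIGEndVert (X : EIG V α) (u : X.Vert) : Prop :=
  ∃! w, EIGAdj X u w

/-! ## Coverings, direct limits, quotient graph, bounded type -/

/-- `p` exhibits the graph `H` as the universal cover of the edge-indexed graph `Y`:
above a vertex mapping to `u`, the number of neighbors above `w` is the index `idx u w`. -/
def IsEIGCover {W : Type} (H : SimpleGraph W) (Y : EIG V α) (p : W → Y.Vert) : Prop :=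
  ∀ x : W, ∀ u : Y.Vert, (H.neighborSet x ∩ p ⁻¹' {u}).ncard = Y.idx (p x) u

/-- `Y` is the direct limit of the system `F` of colored edge-indexed graphs along the
inclusions `ι`. -/
def IsDirLimit (F : ℕ → EIG V α) (ι : ∀ k, (F k).Vert → (F (k + 1)).Vert)
    (Y : EIG V α) : Prop :=
  ∃ j : ∀ k, (F k).Vert → Y.Vert,
    (∀ k v, j (k + 1) (ι k v) = j k v) ∧
    (∀ k, Function.Injective (j k)) ∧
    (∀ y, ∃ k v, j k v = y) ∧
    (∀ k v, Y.col (j k v) = (F k).col v) ∧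
    (∀ y z : Y.Vert, ∃ N, ∀ k, N ≤ k → ∀ v w, j k v = y → j k w = z →
      Y.idx y z = (F k).idx v w)

/-- The coloring `φ` is of bounded type: every vertex has finite type set. -/
def BoundedType (G : SimpleGraph V) (φ : V → α) : Prop :=
  ∀ v : V, {m : ℕ | IsSpecialVert G φ m v}.Finite

/-- Two vertices are related if some color-preserving automorphism maps one to the other. -/
def colorOrbitRel (G : SimpleGraph V) (φ : V → α) (x y : V) : Prop :=
  ∃ g : V ≃ V, (∀ u w, G.Adj u w ↔ G.Adj (g u) (g w)) ∧ (∀ u, φ (g u) = φ u) ∧ g x = y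

/-- The quotient graph `X_φ = G\T` as a colored edge-indexed graph. -/
def quotEIG (G : SimpleGraph V) (φ : V → α) : EIG V α where
  Vert := Quot (colorOrbitRel G φ)
  idx := fun u w => (G.neighborSet u.out ∩ {z | Quot.mk (colorOrbitRel G φ) z = w}).ncard
  col := fun u => φ u.out
  lab := fun u => {z | Quot.mk (colorOrbitRel G φ) z = u}

/-! ## The sequences `n_k`, `α_k`, `β_k` -/

/-- At level `n`, one of `A_n, B_n` is `S_n` or `C_n`. -/
def SpecTouch (L : Labeling G φ a b) (n : ℕ) : Prop :=
  L.A n = L.S n ∨ L.A n = L.C n ∨ L.B n = L.S n ∨ L.B n = L.C n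

/-- `nk` is the increasing enumeration of the levels where `SpecTouch` holds. -/
def IsNkSeq (L : Labeling G φ a b) (nk : ℕ → ℕ) : Prop :=
  StrictMono nk ∧ ∀ n, (∃ k, nk k = n) ↔ SpecTouch L n

/-- `αs` is the sequence `α_k`: `α_K = A`, and for `k ≠ K`, `α_k` is the side whose
graph `G^{α_k}_{n_k}` has more vertices. -/
def IsAlphaSeq (L : Labeling G φ a b) (nk : ℕ → ℕ) (K : ℕ∞) (αs : ℕ → Bool) : Prop :=
  ∀ k : ℕ, ((k : ℕ∞) = K → αs k = true) ∧
    ((k : ℕ∞) ≠ K → (αs k = true ↔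
      (VGside L (nk k) false).ncard < (VGside L (nk k) true).ncard))

/-- The sequence `β_k(t)`: `β_{k-1}(t)` is the letter `ᾱ_k` if the class of the
`n_k`-ball at `t` is a vertex of `G^{ᾱ_k}_{n_k}`, and `α_k` otherwise. -/
def betaOf (L : Labeling G φ a b) (nk : ℕ → ℕ) (αs : ℕ → Bool) (t : V) (k : ℕ) : Bool :=
  if ballClass G φ (nk (k + 1)) t ∈ VGside L (nk (k + 1)) (!(αs (k + 1))) then
    !(αs (k + 1))
  else αs (k + 1)

end Sturm

namespace Sturm

section Lemmas

variable {V α : Type} {G : SimpleGraph V} {φ : V → α} {a b : α}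

section Equivalence

theorem BallEquiv.refl (n : ℕ) (x : V) : BallEquiv G φ n x x :=
  ⟨Equiv.refl _, fun _ _ => Iff.rfl, fun _ => rfl, rfl⟩

theorem BallEquiv.symm {n : ℕ} {x y : V} (h : BallEquiv G φ n x y) : BallEquiv G φ n y x := by
  obtain ⟨f, hadj, hcol, hcen⟩ := h
  refine ⟨f.symm, fun u v => ?_, fun u => ?_, ?_⟩
  · rw [hadj, f.apply_symm_apply, f.apply_symm_apply]
  · rw [← hcol, f.apply_symm_apply]
  · rw [show (⟨y, _⟩ : {z : V // G.dist y z ≤ n}) = f _ from Subtype.ext hcen.symm,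
      f.symm_apply_apply]

theorem BallEquiv.trans {n : ℕ} {x y z : V} (h : BallEquiv G φ n x y)
    (h' : BallEquiv G φ n y z) : BallEquiv G φ n x z := by
  obtain ⟨f, hadj, hcol, hcen⟩ := h
  obtain ⟨g, hadj', hcol', hcen'⟩ := h'
  refine ⟨f.trans g, fun u v => ?_, fun u => ?_, ?_⟩
  · rw [hadj, hadj']; rfl
  · rw [Equiv.trans_apply, hcol', hcol]
  · rw [Equiv.trans_apply, show f _ = ⟨y, by simp⟩ from Subtype.ext hcen, hcen']

/-- A map between balls which preserves adjacency does not increase the length of walks that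
stay in the ball. -/
theorem dist_map_le_walk_length (hG : G.Connected) {N : ℕ} {x y : V}
    (f : {z : V // G.dist x z ≤ N} → {z : V // G.dist y z ≤ N})
    (hadj : ∀ u v : {z : V // G.dist x z ≤ N}, G.Adj u.1 v.1 → G.Adj (f u).1 (f v).1)
    {z u : V} (p : G.Walk z u) (hz : G.dist x z ≤ N) (hu : G.dist x u ≤ N)
    (hp : G.dist x z + p.length ≤ N) :
    G.dist (f ⟨z, hz⟩).1 (f ⟨u, hu⟩).1 ≤ p.length := by
  induction p with
  | nil => simp
  | @cons z w u h p ih =>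
    rw [SimpleGraph.Walk.length_cons] at hp ⊢
    have hxw : G.dist x w ≤ G.dist x z + 1 := by
      have := hG.dist_triangle (u := x) (v := z) (w := w)
      rwa [SimpleGraph.dist_eq_one_iff_adj.2 h] at this
    have hw : G.dist x w ≤ N := by omega
    have h1 := ih hw hu (by omega)
    have h2 := SimpleGraph.dist_eq_one_iff_adj.2 (hadj ⟨z, hz⟩ ⟨w, hw⟩ h)
    have h3 := hG.dist_triangle (u := (f ⟨z, hz⟩).1) (v := (f ⟨w, hw⟩).1) (w := (f ⟨u, hu⟩).1)
    omega

/-- An equivalence of large balls restricts to equivalences of the smaller balls they contain. -/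
theorem BallEquiv.restrict (hG : G.Connected) {N n : ℕ} {x y z : V}
    (h : BallEquiv G φ N x y) (hz : G.dist x z + n ≤ N) :
    ∃ z', G.dist y z' ≤ G.dist x z ∧ (G.Adj x z → G.Adj y z') ∧ (x = z → y = z') ∧
      BallEquiv G φ n z z' := by
  obtain ⟨f, hadj, hcol, hcen⟩ := h
  have hzN : G.dist x z ≤ N := by omega
  have hxN : G.dist x x ≤ N := by simp
  set z' := f ⟨z, hzN⟩ with hz'
  have hd : G.dist y z' ≤ G.dist x z := by
    obtain ⟨p, hp⟩ := hG.exists_walk_length_eq_dist x z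
    have := dist_map_le_walk_length hG f (fun u v => (hadj u v).1) p hxN hzN (by simp; omega)
    rwa [hcen, hp] at this
  have hadj' : ∀ u v : {z : V // G.dist y z ≤ N},
      G.Adj u.1 v.1 → G.Adj (f.symm u).1 (f.symm v).1 := fun u v huv => by
    rw [hadj, f.apply_symm_apply, f.apply_symm_apply]; exact huv
  have hmem : ∀ {u : V}, G.dist z u ≤ n → G.dist x u ≤ N := fun {u} hu => by
    have := hG.dist_triangle (u := x) (v := z) (w := u); omega
  have hmem' : ∀ {u : V}, G.dist z'.1 u ≤ n → G.dist y u ≤ N := fun {u} hu => by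
    have := hG.dist_triangle (u := y) (v := z'.1) (w := u); omega
  have hto : ∀ {u : V} (hu : G.dist z u ≤ n), G.dist z'.1 (f ⟨u, hmem hu⟩).1 ≤ n := fun {u} hu => by
    obtain ⟨p, hp⟩ := hG.exists_walk_length_eq_dist z u
    have := dist_map_le_walk_length hG f (fun u v => (hadj u v).1) p hzN (hmem hu) (by omega)
    rw [← hz'] at this
    omega
  have hinv : ∀ {u : V} (hu : G.dist z'.1 u ≤ n),
      G.dist z (f.symm ⟨u, hmem' hu⟩).1 ≤ n := fun {u} hu => by
    obtain ⟨p, hp⟩ := hG.exists_walk_length_eq_dist z'.1 u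
    have := dist_map_le_walk_length hG f.symm hadj' p z'.2 (hmem' hu) (by omega)
    have hsymm : f.symm ⟨z'.1, z'.2⟩ = ⟨z, hzN⟩ := f.symm_apply_apply _
    rw [hsymm] at this
    dsimp only at this
    omega
  refine ⟨z'.1, hd, fun h => ?_, fun h => ?_, ⟨⟨fun u => ⟨(f ⟨u.1, hmem u.2⟩).1, hto u.2⟩,
    fun u => ⟨(f.symm ⟨u.1, hmem' u.2⟩).1, hinv u.2⟩, fun u => ?_, fun u => ?_⟩,
    fun u v => ?_, fun u => ?_, ?_⟩⟩
  · have := (hadj ⟨x, hxN⟩ ⟨z, hzN⟩).1 h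
    rwa [hcen] at this
  · subst h; exact hcen.symm
  · simp
  · simp
  · exact hadj ⟨u.1, hmem u.2⟩ ⟨v.1, hmem v.2⟩
  · exact hcol ⟨u.1, hmem u.2⟩
  · rfl

theorem BallEquiv.mono (hG : G.Connected) {m n : ℕ} (hmn : m ≤ n) {x y : V}
    (h : BallEquiv G φ n x y) : BallEquiv G φ m x y := by
  obtain ⟨z', -, -, he, hz'⟩ := h.restrict hG (n := m) (z := x) (by simpa using hmn)
  rwa [← he rfl] at hz'

theorem BallEquiv.exists_adj (hG : G.Connected) {n : ℕ} {x y z : V}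
    (h : BallEquiv G φ (n + 1) x y) (hz : G.Adj x z) :
    ∃ z', G.Adj y z' ∧ BallEquiv G φ n z z' := by
  obtain ⟨z', -, ha, -, hz'⟩ := h.restrict hG (n := n) (z := z)
    (by rw [SimpleGraph.dist_eq_one_iff_adj.2 hz, add_comm])
  exact ⟨z', ha hz, hz'⟩

theorem ballClass_eq_iff {n : ℕ} {x y : V} :
    ballClass G φ n x = ballClass G φ n y ↔ BallEquiv G φ n x y := by
  constructor
  · intro h
    have : y ∈ ballClass G φ n y := BallEquiv.refl n y
    rwa [← h] at this
  · intro h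
    ext z
    exact ⟨fun hz => h.symm.trans hz, fun hz => h.trans hz⟩

/-- For a Sturmian coloring, of the two extensions of the special ball, any given one is
involved in every splitting. -/
theorem IsSturmian.equiv_or_equiv (hG : G.Connected) (hSt : IsSturmian G φ) {n : ℕ}
    {x y u v : V} (hxy : BallEquiv G φ n x y) (hxy' : ¬ BallEquiv G φ (n + 1) x y)
    (huv : BallEquiv G φ n u v) (huv' : ¬ BallEquiv G φ (n + 1) u v) :
    BallEquiv G φ (n + 1) y u ∨ BallEquiv G φ (n + 1) y v := by
  by_contra! hcon
  let ρ : Set V → Set V := fun C => {w | ∃ z ∈ C, BallEquiv G φ n z w}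
  have hρ : ∀ z, ρ (ballClass G φ (n + 1) z) = ballClass G φ n z := fun z => by
    ext w
    exact ⟨fun ⟨t, ht, htw⟩ => (BallEquiv.mono hG n.le_succ ht).trans htw,
      fun h => ⟨z, BallEquiv.refl _ _, h⟩⟩
  set s := ballClasses G φ (n + 1) \ {ballClass G φ (n + 1) y} with hs
  have hmem : ∀ {z}, ¬ BallEquiv G φ (n + 1) y z → ballClass G φ (n + 1) z ∈ s := fun {z} hz =>
    ⟨⟨z, rfl⟩, fun h => hz (ballClass_eq_iff.1 h.symm)⟩
  have himg : ρ '' s = ballClasses G φ n := by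
    ext C
    constructor
    · rintro ⟨_, ⟨⟨z, rfl⟩, -⟩, rfl⟩
      exact ⟨z, hρ z⟩
    · rintro ⟨z, rfl⟩
      by_cases hz : BallEquiv G φ (n + 1) y z
      · exact ⟨_, hmem fun h => hxy' h.symm, (hρ x).trans
          (ballClass_eq_iff.2 (hxy.trans (hz.mono hG n.le_succ)))⟩
      · exact ⟨_, hmem hz, hρ z⟩
  have hfin : (ballClasses G φ (n + 1)).Finite :=
    Set.finite_of_ncard_ne_zero (by rw [hSt]; omega)
  have hcard : (ρ '' s).ncard = s.ncard := by
    rw [himg, hSt, hs, Set.ncard_sdiff_singleton_of_mem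
      (show ballClass G φ (n + 1) y ∈ ballClasses G φ (n + 1) from ⟨y, rfl⟩), hSt]
    omega
  have hinj := Set.injOn_of_ncard_image_eq hcard (hfin.subset Set.sdiff_subset)
  exact huv' (ballClass_eq_iff.1 (hinj (hmem hcon.1) (hmem hcon.2)
    (by rw [hρ, hρ]; exact ballClass_eq_iff.2 huv)))

theorem _root_.SimpleGraph.Connected.eq_univ_of_adj_closed (hG : G.Connected) {s : Set V}
    (hs : s.Nonempty) (h : ∀ x ∈ s, ∀ y, G.Adj x y → y ∈ s) : s = Set.univ := by
  obtain ⟨x, hx⟩ := hs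
  refine Set.eq_univ_of_forall fun y => ?_
  obtain ⟨p⟩ := hG.preconnected x y
  induction p with
  | nil => exact hx
  | cons hadj p ih => exact ih (h _ hx _ hadj)

end Equivalence

namespace Labeling

variable (L : Labeling G φ a b) {n : ℕ} {x y : V}

theorem exists_S_eq (n : ℕ) : ∃ x, L.S n = ballClass G φ n x :=
  let ⟨x, hx, _⟩ := L.S_special n
  ⟨x, hx⟩

theorem exists_A_eq : ∀ n, ∃ x, L.A n = ballClass G φ n x
  | 0 => let ⟨x, _, hx⟩ := L.A0_col; ⟨x, hx⟩
  | n + 1 => let ⟨x, _, _, hx⟩ := L.A_ext n; ⟨x, hx⟩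

theorem exists_B_eq : ∀ n, ∃ x, L.B n = ballClass G φ n x
  | 0 => let ⟨x, _, hx⟩ := L.B0_col; ⟨x, hx⟩
  | n + 1 => let ⟨x, _, _, hx⟩ := L.B_ext n; ⟨x, hx⟩

theorem nonempty_S (n : ℕ) : (L.S n).Nonempty := by
  obtain ⟨x, hx⟩ := L.exists_S_eq n
  exact ⟨x, hx ▸ BallEquiv.refl n x⟩

theorem nonempty_A (n : ℕ) : (L.A n).Nonempty := by
  obtain ⟨x, hx⟩ := L.exists_A_eq n
  exact ⟨x, hx ▸ BallEquiv.refl n x⟩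

theorem nonempty_B (n : ℕ) : (L.B n).Nonempty := by
  obtain ⟨x, hx⟩ := L.exists_B_eq n
  exact ⟨x, hx ▸ BallEquiv.refl n x⟩

variable {L}

theorem mem_S_iff (hx : x ∈ L.S n) : y ∈ L.S n ↔ BallEquiv G φ n x y := by
  obtain ⟨z, hz⟩ := L.exists_S_eq n
  rw [hz] at hx ⊢
  exact ⟨fun h => BallEquiv.trans (BallEquiv.symm hx) h, fun h => BallEquiv.trans hx h⟩

theorem mem_A_iff (hx : x ∈ L.A n) : y ∈ L.A n ↔ BallEquiv G φ n x y := by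
  obtain ⟨z, hz⟩ := L.exists_A_eq n
  rw [hz] at hx ⊢
  exact ⟨fun h => BallEquiv.trans (BallEquiv.symm hx) h, fun h => BallEquiv.trans hx h⟩

theorem mem_B_iff (hx : x ∈ L.B n) : y ∈ L.B n ↔ BallEquiv G φ n x y := by
  obtain ⟨z, hz⟩ := L.exists_B_eq n
  rw [hz] at hx ⊢
  exact ⟨fun h => BallEquiv.trans (BallEquiv.symm hx) h, fun h => BallEquiv.trans hx h⟩

theorem A_subset_S (hG : G.Connected) : L.A (n + 1) ⊆ L.S n := by
  obtain ⟨x, -, hS, hA⟩ := L.A_ext n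
  rw [hS, hA]
  exact fun y hy => BallEquiv.mono hG n.le_succ hy

theorem B_subset_S (hG : G.Connected) : L.B (n + 1) ⊆ L.S n := by
  obtain ⟨x, -, hS, hB⟩ := L.B_ext n
  rw [hS, hB]
  exact fun y hy => BallEquiv.mono hG n.le_succ hy

theorem not_equiv_of_mem_A_of_mem_B (hx : x ∈ L.A (n + 1)) (hy : y ∈ L.B (n + 1)) :
    ¬ BallEquiv G φ (n + 1) x y := fun h => L.AB_ne n <| by
  ext z
  rw [mem_A_iff hx, mem_B_iff hy]
  exact ⟨fun hz => h.symm.trans hz, fun hz => h.trans hz⟩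

theorem mem_A_or_mem_B (hG : G.Connected) (hSt : IsSturmian G φ) (hx : x ∈ L.S n) :
    x ∈ L.A (n + 1) ∨ x ∈ L.B (n + 1) := by
  obtain ⟨u, hu⟩ := L.nonempty_A (n + 1)
  obtain ⟨v, hv⟩ := L.nonempty_B (n + 1)
  rw [mem_A_iff hu, mem_B_iff hv, or_iff_not_imp_left]
  intro hux
  have huS := A_subset_S hG hu
  exact (hSt.equiv_or_equiv hG ((mem_S_iff huS).1 (B_subset_S hG hv))
    (not_equiv_of_mem_A_of_mem_B hu hv) ((mem_S_iff huS).1 hx) hux).resolve_left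
    fun h => not_equiv_of_mem_A_of_mem_B hu hv h.symm

theorem equiv_succ_of_notMem_S (hG : G.Connected) (hSt : IsSturmian G φ)
    (hx : x ∉ L.S n) (h : BallEquiv G φ n x y) : BallEquiv G φ (n + 1) x y := by
  by_contra hxy
  obtain ⟨u, hu⟩ := L.nonempty_A (n + 1)
  obtain ⟨v, hv⟩ := L.nonempty_B (n + 1)
  have hvS := B_subset_S hG hv
  rcases hSt.equiv_or_equiv hG ((mem_S_iff (A_subset_S hG hu)).1 hvS)
    (not_equiv_of_mem_A_of_mem_B hu hv) h hxy with h' | h'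
  · exact hx ((mem_S_iff hvS).2 (h'.mono hG n.le_succ))
  · exact hx ((mem_S_iff hvS).2 ((h'.mono hG n.le_succ).trans h.symm))

theorem equiv_of_forall_notMem_S (hG : G.Connected) (hSt : IsSturmian G φ)
    (hx : ∀ k ≥ n, x ∉ L.S k) (h : BallEquiv G φ n x y) (k : ℕ) : BallEquiv G φ k x y := by
  rcases le_total k n with hk | hk
  · exact h.mono hG hk
  · induction k, hk using Nat.le_induction with
    | base => exact h
    | succ k hk ih => exact equiv_succ_of_notMem_S hG hSt (hx k hk) ih

theorem mem_A_zero_or_mem_B_zero (hSt : IsSturmian G φ) (hab : a ≠ b) (x : V) :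
    x ∈ L.A 0 ∨ x ∈ L.B 0 := by
  obtain ⟨u, hu, hA⟩ := L.A0_col
  obtain ⟨v, hv, hB⟩ := L.B0_col
  have hne : ballClass G φ 0 u ≠ ballClass G φ 0 v := fun h => by
    obtain ⟨f, -, hcol, hcen⟩ := ballClass_eq_iff.1 h
    have := hcol ⟨u, by simp⟩
    rw [hcen, hu, hv] at this
    exact hab this.symm
  have hpair : ({ballClass G φ 0 u, ballClass G φ 0 v} : Set (Set V)) = ballClasses G φ 0 := by
    refine Set.eq_of_subset_of_ncard_le ?_ ?_ (Set.finite_of_ncard_ne_zero (by rw [hSt]; omega))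
    · rintro _ (rfl | rfl)
      exacts [⟨u, rfl⟩, ⟨v, rfl⟩]
    · rw [hSt, Set.ncard_pair hne]
  have hx : ballClass G φ 0 x ∈ ballClasses G φ 0 := ⟨x, rfl⟩
  rw [← hpair] at hx
  rw [hA, hB]
  exact hx.imp (fun h => (ballClass_eq_iff.1 h).symm) fun h => (ballClass_eq_iff.1 h).symm

/-- A vertex next to a special `n`-ball whose class neither is born at level `n` nor is special
at levels `n` and `n + 1` has neighbors in both extensions of the special `n`-ball. -/
theorem exists_adj_A_and_exists_adj_B (hG : G.Connected) (hSt : IsSturmian G φ) (hab : a ≠ b)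
    (hxA : x ∉ L.A n) (hxB : x ∉ L.B n) (hx : x ∉ L.S n) (hx' : x ∉ L.S (n + 1))
    (hxy : G.Adj x y) (hy : y ∈ L.S n) :
    (∃ z ∈ L.A (n + 1), G.Adj x z) ∧ ∃ z ∈ L.B (n + 1), G.Adj x z := by
  have key : ∀ w ∈ L.S n, ∃ z, BallEquiv G φ (n + 1) w z ∧ G.Adj x z := fun w hw => by
    cases n with
    | zero => exact ((mem_A_zero_or_mem_B_zero hSt hab x).elim hxA hxB).elim
    | succ n =>
      obtain ⟨x', hwx', hxx'⟩ := ((mem_S_iff hy).1 hw).exists_adj hG hxy.symm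
      have h1 := equiv_succ_of_notMem_S hG hSt
        (fun h => (mem_A_or_mem_B hG hSt h).elim hxA hxB) hxx'
      have h2 := equiv_succ_of_notMem_S hG hSt hx' (equiv_succ_of_notMem_S hG hSt hx h1)
      obtain ⟨z, hz, hwz⟩ := h2.symm.exists_adj hG hwx'.symm
      exact ⟨z, hwz, hz⟩
  obtain ⟨u, hu⟩ := L.nonempty_A (n + 1)
  obtain ⟨v, hv⟩ := L.nonempty_B (n + 1)
  obtain ⟨z, huz, hz⟩ := key u (A_subset_S hG hu)
  obtain ⟨z', hvz', hz'⟩ := key v (B_subset_S hG hv)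
  exact ⟨⟨z, (mem_A_iff hu).2 huz, hz⟩, ⟨z', (mem_B_iff hv).2 hvz', hz'⟩⟩

end Labeling

/-- From some level on, the partition of a finite set of vertices into classes is constant. -/
theorem exists_equiv_stable (hG : G.Connected) {s : Set V} (hs : s.Finite) :
    ∃ N, ∀ k ≥ N, ∀ u ∈ s, ∀ v ∈ s, BallEquiv G φ k u v → BallEquiv G φ (k + 1) u v := by
  have h : ∀ p : V × V, ∃ N, ∀ k ≥ N, BallEquiv G φ k p.1 p.2 → BallEquiv G φ (k + 1) p.1 p.2 := by
    intro p
    by_cases hp : ∀ k, BallEquiv G φ k p.1 p.2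
    · exact ⟨0, fun k _ _ => hp _⟩
    · push Not at hp
      obtain ⟨N, hN⟩ := hp
      exact ⟨N, fun k hk h => (hN (h.mono hG hk)).elim⟩
  choose N hN using h
  obtain ⟨M, hM⟩ := ((hs.prod hs).image N).bddAbove
  exact ⟨M, fun k hk u hu v hv => hN (u, v) k
    ((hM (Set.mem_image_of_mem N (Set.mk_mem_prod hu hv))).trans hk)⟩

/-- `x` has neighbors `z₁, z₂, z₃` such that the `n`-balls at `x, z₁, z₂, z₃` are pairwise
inequivalent. -/
def IsBranch (G : SimpleGraph V) (φ : V → α) (n : ℕ) (x : V) : Prop :=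
  ∃ z : Fin 3 → V, (∀ i, G.Adj x (z i)) ∧ (∀ i, ¬ BallEquiv G φ n x (z i)) ∧
    ∀ i j, i ≠ j → ¬ BallEquiv G φ n (z i) (z j)

/-- The `k`-balls that occur at the center of arbitrarily large regions of the tree free
of `c`. -/
def freeSet (G : SimpleGraph V) (φ : V → α) (c : Set V) (k : ℕ) : Set V :=
  {v | ∀ R : ℕ, ∃ w, BallEquiv G φ k v w ∧ ∀ u, G.dist w u ≤ R → u ∉ c}

section FreeSet

variable {c : Set V} {n k : ℕ} {x y : V}

theorem mem_freeSet_of_equiv (hx : x ∈ freeSet G φ c k) (h : BallEquiv G φ k x y) :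
    y ∈ freeSet G φ c k := fun R =>
  let ⟨w, hw, hR⟩ := hx R
  ⟨w, h.symm.trans hw, hR⟩

theorem freeSet_antitone (hG : G.Connected) : Antitone (freeSet G φ c) := fun _ _ hkn _ hx R =>
  let ⟨w, hw, hR⟩ := hx R
  ⟨w, hw.mono hG hkn, hR⟩

theorem mem_freeSet_of_adj (hG : G.Connected) (hx : x ∈ freeSet G φ c (k + 1))
    (h : G.Adj x y) : y ∈ freeSet G φ c k := fun R => by
  obtain ⟨w, hw, hR⟩ := hx (R + 1)
  obtain ⟨y', hwy', hyy'⟩ := hw.exists_adj hG h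
  refine ⟨y', hyy', fun u hu => hR u ?_⟩
  have := hG.dist_triangle (u := w) (v := y') (w := u)
  rw [SimpleGraph.dist_eq_one_iff_adj.2 hwy'] at this
  omega

theorem mem_freeSet_succ_of_notMem_S (hG : G.Connected) (hSt : IsSturmian G φ)
    (L : Labeling G φ a b) (hx : x ∈ freeSet G φ c k) (hxS : x ∉ L.S k) :
    x ∈ freeSet G φ c (k + 1) := fun R =>
  let ⟨w, hw, hR⟩ := hx R
  ⟨w, Labeling.equiv_succ_of_notMem_S hG hSt hxS hw, hR⟩

theorem mem_freeSet_or_mem_freeSet {u v : V}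
    (hx : ∀ R : ℕ, ∃ w, (BallEquiv G φ k u w ∨ BallEquiv G φ k v w) ∧
      ∀ t, G.dist w t ≤ R → t ∉ c) :
    u ∈ freeSet G φ c k ∨ v ∈ freeSet G φ c k := by
  by_contra! hcon
  simp only [freeSet, Set.mem_ofPred_eq, not_forall, not_exists, not_and] at hcon
  obtain ⟨⟨R, hR⟩, R', hR'⟩ := hcon
  obtain ⟨w, hw | hw, hwR⟩ := hx (max R R')
  · obtain ⟨t, ht, htc⟩ := hR w hw
    exact hwR t (ht.trans (le_max_left _ _)) (not_not.1 htc)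
  · obtain ⟨t, ht, htc⟩ := hR' w hw
    exact hwR t (ht.trans (le_max_right _ _)) (not_not.1 htc)

theorem exists_mem_freeSet_succ (hG : G.Connected) (hSt : IsSturmian G φ)
    (L : Labeling G φ a b) (hx : x ∈ freeSet G φ c k) :
    ∃ y ∈ freeSet G φ c (k + 1), BallEquiv G φ k x y := by
  by_cases hxS : x ∈ L.S k
  · obtain ⟨u, hu⟩ := L.nonempty_A (k + 1)
    obtain ⟨v, hv⟩ := L.nonempty_B (k + 1)
    have huv : u ∈ freeSet G φ c (k + 1) ∨ v ∈ freeSet G φ c (k + 1) :=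
      mem_freeSet_or_mem_freeSet fun R => by
        obtain ⟨w, hw, hR⟩ := hx R
        refine ⟨w, ?_, hR⟩
        rw [← Labeling.mem_A_iff hu, ← Labeling.mem_B_iff hv]
        exact Labeling.mem_A_or_mem_B hG hSt ((Labeling.mem_S_iff hxS).2 hw)
    rcases huv with h | h
    · exact ⟨u, h, (Labeling.mem_S_iff hxS).1 (Labeling.A_subset_S hG hu)⟩
    · exact ⟨v, h, (Labeling.mem_S_iff hxS).1 (Labeling.B_subset_S hG hv)⟩
  · exact ⟨x, mem_freeSet_succ_of_notMem_S hG hSt L hx hxS, BallEquiv.refl _ _⟩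

theorem freeSet_nonempty (hG : G.Connected) (hSt : IsSturmian G φ) (hab : a ≠ b)
    (L : Labeling G φ a b) (hc : ∀ R : ℕ, ∃ v, ∀ u, G.dist v u ≤ R → u ∉ c) (k : ℕ) :
    (freeSet G φ c k).Nonempty := by
  induction k with
  | zero =>
    obtain ⟨u, hu⟩ := L.nonempty_A 0
    obtain ⟨v, hv⟩ := L.nonempty_B 0
    have huv : u ∈ freeSet G φ c 0 ∨ v ∈ freeSet G φ c 0 :=
      mem_freeSet_or_mem_freeSet fun R => by
        obtain ⟨w, hR⟩ := hc R
        refine ⟨w, ?_, hR⟩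
        rw [← Labeling.mem_A_iff hu, ← Labeling.mem_B_iff hv]
        exact Labeling.mem_A_zero_or_mem_B_zero hSt hab w
    exact huv.elim (fun h => ⟨u, h⟩) fun h => ⟨v, h⟩
  | succ k ih =>
    obtain ⟨x, hx⟩ := ih
    obtain ⟨y, hy, -⟩ := exists_mem_freeSet_succ hG hSt L hx
    exact ⟨y, hy⟩

theorem S_subset_freeSet (hG : G.Connected) (hSt : IsSturmian G φ) (hab : a ≠ b)
    (L : Labeling G φ a b) (hc : ∀ R : ℕ, ∃ v, ∀ u, G.dist v u ≤ R → u ∉ c)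
    (hx : x ∉ freeSet G φ c k) : L.S k ⊆ freeSet G φ c k := by
  intro s hs
  by_contra hsY
  have hdisj : ∀ v ∈ freeSet G φ c k, v ∉ L.S k := fun v hv hvS =>
    hsY (mem_freeSet_of_equiv hv ((Labeling.mem_S_iff hvS).1 hs))
  have := hG.eq_univ_of_adj_closed (freeSet_nonempty hG hSt hab L hc k) fun v hv w hvw =>
    mem_freeSet_of_adj hG (mem_freeSet_succ_of_notMem_S hG hSt L hv (hdisj v hv)) hvw
  exact hx (this ▸ Set.mem_univ x)

theorem equiv_of_notMem_freeSet {w : V} (L : Labeling G φ a b) (hw : w ∈ freeSet G φ c k)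
    (hx : x ∉ freeSet G φ c k) (hy : y ∉ freeSet G φ c k) (hwAB : w ∈ L.A k ∨ w ∈ L.B k)
    (hxAB : x ∈ L.A k ∨ x ∈ L.B k) (hyAB : y ∈ L.A k ∨ y ∈ L.B k) : BallEquiv G φ k x y := by
  rcases hwAB with h | h
  · have hB : ∀ {v}, v ∉ freeSet G φ c k → v ∈ L.A k ∨ v ∈ L.B k → v ∈ L.B k := fun hv hAB =>
      hAB.resolve_left fun hA => hv (mem_freeSet_of_equiv hw ((Labeling.mem_A_iff h).1 hA))
    exact (Labeling.mem_B_iff (hB hx hxAB)).1 (hB hy hyAB)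
  · have hA : ∀ {v}, v ∉ freeSet G φ c k → v ∈ L.A k ∨ v ∈ L.B k → v ∈ L.A k := fun hv hAB =>
      hAB.resolve_right fun hB => hv (mem_freeSet_of_equiv hw ((Labeling.mem_B_iff h).1 hB))
    exact (Labeling.mem_A_iff (hA hx hxAB)).1 (hA hy hyAB)

/-- Two vertices that leave the sets `freeSet` at the same level have equivalent balls of
all radii. -/
theorem equiv_of_leave_freeSet (hG : G.Connected) (hSt : IsSturmian G φ) (hab : a ≠ b)
    (L : Labeling G φ a b) (hc : ∀ R : ℕ, ∃ v, ∀ u, G.dist v u ≤ R → u ∉ c)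
    (hx : x ∉ freeSet G φ c k) (hy : y ∉ freeSet G φ c k)
    (hx' : ∀ j < k, x ∈ freeSet G φ c j) (hy' : ∀ j < k, y ∈ freeSet G φ c j) (m : ℕ) :
    BallEquiv G φ m x y := by
  refine Labeling.equiv_of_forall_notMem_S (L := L) (n := k) hG hSt (fun j hj hxS => ?_) ?_ m
  · have hxj : x ∉ freeSet G φ c j := fun h => hx (freeSet_antitone hG hj h)
    exact hxj (S_subset_freeSet hG hSt hab L hc hxj hxS)
  cases k with
  | zero =>
    obtain ⟨w, hw⟩ := freeSet_nonempty hG hSt hab L hc 0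
    exact equiv_of_notMem_freeSet L hw hx hy (Labeling.mem_A_zero_or_mem_B_zero hSt hab w)
      (Labeling.mem_A_zero_or_mem_B_zero hSt hab x) (Labeling.mem_A_zero_or_mem_B_zero hSt hab y)
  | succ k =>
    have hS : ∀ {v}, v ∈ freeSet G φ c k → v ∉ freeSet G φ c (k + 1) → v ∈ L.S k := fun hv hv' =>
      not_not.1 fun h => hv' (mem_freeSet_succ_of_notMem_S hG hSt L hv h)
    have hxS := hS (hx' k k.lt_succ_self) hx
    obtain ⟨w, hw, hxw⟩ := exists_mem_freeSet_succ hG hSt L (hx' k k.lt_succ_self)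
    exact equiv_of_notMem_freeSet L hw hx hy
      (Labeling.mem_A_or_mem_B hG hSt ((Labeling.mem_S_iff hxS).2 hxw))
      (Labeling.mem_A_or_mem_B hG hSt hxS)
      (Labeling.mem_A_or_mem_B hG hSt (hS (hy' k k.lt_succ_self) hy))

end FreeSet

theorem exists_ne_iff_of_fin_three (p : Fin 3 → Prop) : ∃ i j, i ≠ j ∧ (p i ↔ p j) := by
  obtain ⟨i, j, hij, h⟩ := Fintype.exists_ne_map_eq_of_card_lt (fun i => decide (p i)) (by simp)
  exact ⟨i, j, hij, decide_eq_decide.1 h⟩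

/-- There are no branches if some ball class misses arbitrarily large regions of the tree. -/
theorem not_isBranch_of_sparse (hG : G.Connected) (hSt : IsSturmian G φ) (hab : a ≠ b)
    (L : Labeling G φ a b) {m : ℕ} {t : V}
    (hc : ∀ R : ℕ, ∃ v, ∀ u, G.dist v u ≤ R → u ∉ ballClass G φ m t) (n : ℕ) (x : V) :
    ¬ IsBranch G φ n x := by
  set c := ballClass G φ m t
  have hleave : ∀ v, ∃ k, v ∉ freeSet G φ c k := fun v => by
    have := hG.eq_univ_of_adj_closed (s := {v | ∃ k, v ∉ freeSet G φ c k})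
      ⟨t, m, fun h => by
        obtain ⟨w, hw, hw'⟩ := h 0
        exact hw' w (by simp) hw⟩
      fun v ⟨k, hk⟩ w hvw => ⟨k + 1, fun h => hk (mem_freeSet_of_adj hG h hvw.symm)⟩
    exact Set.eq_univ_iff_forall.1 this v
  let τ : V → ℕ := fun v => Nat.find (hleave v)
  have hle : ∀ {u v}, G.Adj u v → τ v ≤ τ u + 1 := fun {u v} huv =>
    Nat.find_min' _ fun h => Nat.find_spec (hleave u) (mem_freeSet_of_adj hG h huv.symm)
  have hequiv : ∀ {u v}, τ u = τ v → BallEquiv G φ n u v := fun {u v} huv =>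
    equiv_of_leave_freeSet (k := τ u) hG hSt hab L hc (Nat.find_spec (hleave u))
      (huv ▸ Nat.find_spec (hleave v)) (fun j hj => not_not.1 (Nat.find_min (hleave u) hj))
      (fun j hj => not_not.1 (Nat.find_min (hleave v) (hj.trans_eq huv))) n
  rintro ⟨z, hxz, hne, hz⟩
  obtain ⟨i, j, hij, h⟩ := exists_ne_iff_of_fin_three fun i => τ (z i) = τ x + 1
  refine hz i j hij (hequiv ?_)
  have hi : τ x ≠ τ (z i) := fun h => hne i (hequiv h)
  have hj : τ x ≠ τ (z j) := fun h => hne j (hequiv h)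
  have := hle (hxz i)
  have := hle (hxz j)
  have := hle (hxz i).symm
  have := hle (hxz j).symm
  omega

/-- A neighbor `x` of a special `n`-ball whose neighbors are not split at level `n` is born at
level `n` or special at level `n` or `n + 1`. -/
theorem Labeling.mem_of_adj_of_stable (hG : G.Connected) (hSt : IsSturmian G φ) (hab : a ≠ b)
    (L : Labeling G φ a b) {n : ℕ} {x y : V} (hxy : G.Adj x y) (hy : y ∈ L.S n)
    (hstable : ∀ u v, G.Adj x u → G.Adj x v → BallEquiv G φ n u v → BallEquiv G φ (n + 1) u v)
    (hx : x ∉ L.S n) : x ∈ L.S (n + 1) ∨ x ∈ L.A n ∨ x ∈ L.B n := by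
  by_contra! hcon
  obtain ⟨⟨z, hzA, hz⟩, z', hzB, hz'⟩ :=
    exists_adj_A_and_exists_adj_B hG hSt hab hcon.2.1 hcon.2.2 hx hcon.1 hxy hy
  exact not_equiv_of_mem_A_of_mem_B hzA hzB (hstable z z' hz hz'
    ((mem_S_iff (A_subset_S hG hzA)).1 (B_subset_S hG hzB)))

/-- Being special at only finitely many levels holds uniformly on balls, as soon as it holds at
all vertices. -/
theorem exists_forall_dist_le_notMem_S (hG : G.Connected) (L : Labeling G φ a b)
    (hfin : ∀ v, (G.neighborSet v).Finite) (h : ∀ x, ∃ K, ∀ k ≥ K, x ∉ L.S k) (R : ℕ) (x : V) :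
    ∃ K, ∀ w, G.dist x w ≤ R → ∀ k ≥ K, w ∉ L.S k := by
  induction R generalizing x with
  | zero =>
    obtain ⟨K, hK⟩ := h x
    refine ⟨K, fun w hw => ?_⟩
    rwa [← hG.dist_eq_zero_iff.1 (Nat.le_zero.1 hw)]
  | succ R ih =>
    obtain ⟨K, hK⟩ := h x
    choose f hf using ih
    obtain ⟨M, hM⟩ := ((hfin x).image f).bddAbove
    refine ⟨max K M, fun w hw k hk => ?_⟩
    obtain ⟨p, hp⟩ := hG.exists_walk_length_eq_dist x w
    cases p with
    | nil => exact hK k ((le_max_left _ _).trans hk)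
    | @cons _ y _ hxy p =>
      rw [SimpleGraph.Walk.length_cons] at hp
      have := SimpleGraph.dist_le p
      exact hf y w (by omega) k
        ((hM (Set.mem_image_of_mem f hxy)).trans ((le_max_right _ _).trans hk))

/-- If every ball class meets all regions of some fixed size, then every vertex is special at
infinitely many levels. -/
theorem exists_ge_mem_S_of_syndetic (hG : G.Connected) (hSt : IsSturmian G φ) (hab : a ≠ b)
    (L : Labeling G φ a b) (hfin : ∀ v, (G.neighborSet v).Finite)
    (hc : ∀ n x, ∃ R, ∀ v, ∃ w, G.dist v w ≤ R ∧ BallEquiv G φ n x w) (n : ℕ) (x : V) :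
    ∃ k ≥ n, x ∈ L.S k := by
  by_contra! hx
  have hall : ∀ v, ∃ K, ∀ k ≥ K, v ∉ L.S k := by
    refine Set.eq_univ_iff_forall.1 (hG.eq_univ_of_adj_closed
      (s := {v | ∃ K, ∀ k ≥ K, v ∉ L.S k}) ⟨x, n, hx⟩ ?_)
    rintro v ⟨K, hK⟩ u hvu
    obtain ⟨N, hN⟩ := exists_equiv_stable (φ := φ) hG (hfin v)
    refine ⟨max (K + 1) N, fun k hk huS => ?_⟩
    have hkK : K + 1 ≤ k := (le_max_left _ _).trans hk
    obtain ⟨k, rfl⟩ : ∃ j, k = j + 1 := ⟨k - 1, by omega⟩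
    rcases L.mem_of_adj_of_stable hG hSt hab hvu huS
      (fun y z hy hz => hN _ ((le_max_right _ _).trans hk) y hy z hz) (hK _ (by omega))
      with h | h | h
    · exact hK _ (by omega) h
    · exact hK k (by omega) (Labeling.A_subset_S hG h)
    · exact hK k (by omega) (Labeling.B_subset_S hG h)
  obtain ⟨R, hR⟩ := hc n x
  obtain ⟨K, hK⟩ := exists_forall_dist_le_notMem_S hG L hfin hall R x
  obtain ⟨w, hw⟩ := L.nonempty_S K
  obtain ⟨y, hwy, hxy⟩ := hR w
  rw [SimpleGraph.dist_comm] at hwy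
  obtain ⟨w', hw', -, -, hww'⟩ := ((Labeling.equiv_of_forall_notMem_S hG hSt hx hxy (K + R)).symm
    ).restrict hG (z := w) (n := K) (by omega)
  exact hK w' (hw'.trans hwy) K le_rfl ((Labeling.mem_S_iff hw).2 hww')

/-- There are no branches if every ball class meets all regions of some fixed size. -/
theorem not_isBranch_of_syndetic (hG : G.Connected) (hSt : IsSturmian G φ) (hab : a ≠ b)
    (L : Labeling G φ a b) (hfin : ∀ v, (G.neighborSet v).Finite)
    (hc : ∀ n x, ∃ R, ∀ v, ∃ w, G.dist v w ≤ R ∧ BallEquiv G φ n x w) (n : ℕ) (x : V) :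
    ¬ IsBranch G φ n x := by
  rintro ⟨z, hxz, hne, hz⟩
  obtain ⟨N, hN⟩ := exists_equiv_stable (φ := φ) hG
    ((hfin x).biUnion fun v _ => hfin v)
  obtain ⟨k, hk, hxS⟩ := exists_ge_mem_S_of_syndetic hG hSt hab L hfin hc (max N (n + 1)) x
  have hkn : n + 1 ≤ k := (le_max_right _ _).trans hk
  obtain ⟨k, rfl⟩ : ∃ j, k = j + 1 := ⟨k - 1, by omega⟩
  have hzS : ∀ i, z i ∉ L.S (k + 2) → z i ∈ L.S k := fun i hi => by
    rcases L.mem_of_adj_of_stable hG hSt hab (hxz i).symm hxS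
      (fun u v hu hv => hN _ ((le_max_left _ _).trans hk) u
        (Set.mem_biUnion (hxz i) hu) v (Set.mem_biUnion (hxz i) hv))
      (fun h => hne i (((Labeling.mem_S_iff hxS).1 h).mono hG (by omega))) with h | h | h
    · exact (hi h).elim
    · exact Labeling.A_subset_S hG h
    · exact Labeling.B_subset_S hG h
  obtain ⟨i, j, hij, h⟩ := exists_ne_iff_of_fin_three fun i => z i ∈ L.S (k + 2)
  by_cases hi : z i ∈ L.S (k + 2)
  · exact hz i j hij (((Labeling.mem_S_iff hi).1 (h.1 hi)).mono hG (by omega))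
  · exact hz i j hij (((Labeling.mem_S_iff (hzS i hi)).1 (hzS j (mt h.2 hi))).mono hG (by omega))

theorem not_isBranch (hG : G.Connected) (hSt : IsSturmian G φ) (hab : a ≠ b)
    (L : Labeling G φ a b) (hfin : ∀ v, (G.neighborSet v).Finite) (n : ℕ) (x : V) :
    ¬ IsBranch G φ n x := by
  by_cases hc : ∀ n x, ∃ R, ∀ v, ∃ w, G.dist v w ≤ R ∧ BallEquiv G φ n x w
  · exact not_isBranch_of_syndetic hG hSt hab L hfin hc n x
  · push Not at hc
    obtain ⟨m, t, hc⟩ := hc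
    exact not_isBranch_of_sparse hG hSt hab L (m := m) (t := t) hc n x

namespace Labeling

variable {L : Labeling G φ a b} {n : ℕ} {x : V}

theorem S_eq_of_mem (hx : x ∈ L.S n) : L.S n = ballClass G φ n x :=
  Set.ext fun _ => mem_S_iff hx

theorem A_eq_of_mem (hx : x ∈ L.A n) : L.A n = ballClass G φ n x :=
  Set.ext fun _ => mem_A_iff hx

theorem B_eq_of_mem (hx : x ∈ L.B n) : L.B n = ballClass G φ n x :=
  Set.ext fun _ => mem_B_iff hx

theorem S_succ_subset_S_of_S_eq_C (hG : G.Connected) (h : L.S n = L.C n) :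
    L.S (n + 1) ⊆ L.S n := by
  obtain ⟨x, -, hS, hC⟩ := L.C_central n
  rw [h, hS, hC]
  exact fun y hy => BallEquiv.mono hG n.le_succ hy

theorem S_eq_C_of_S_succ_subset (h : L.S (n + 1) ⊆ L.S n) : L.S n = L.C n := by
  obtain ⟨x, -, hS, hC⟩ := L.C_central n
  rw [hC]
  exact S_eq_of_mem (h (hS ▸ BallEquiv.refl _ _))

theorem S_succ_eq_A_or_eq_B (hG : G.Connected) (hSt : IsSturmian G φ) (h : L.S n = L.C n) :
    L.S (n + 1) = L.A (n + 1) ∨ L.S (n + 1) = L.B (n + 1) := by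
  obtain ⟨x, hx⟩ := L.nonempty_S (n + 1)
  rw [S_eq_of_mem hx]
  exact (mem_A_or_mem_B hG hSt (S_succ_subset_S_of_S_eq_C hG h hx)).imp
    (fun h => (A_eq_of_mem h).symm) fun h => (B_eq_of_mem h).symm

/-- If the central balls of consecutive special balls are special, and the second of them is
the extension labeled `A` of the first, then the first one carries the label `A` too. -/
theorem S_eq_A_of_succ (hG : G.Connected) (hSt : IsSturmian G φ)
    (hbr : ∀ x, ¬ IsBranch G φ (n + 2) x) (hA : L.S (n + 1) = L.A (n + 1))
    (hC : L.S (n + 1) = L.C (n + 1)) :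
    L.S n = L.A n := by
  by_contra hne
  have hdisj : ∀ {u}, u ∈ L.A n → u ∉ L.S n := fun hu hu' =>
    hne ((S_eq_of_mem hu').trans (A_eq_of_mem hu).symm)
  obtain ⟨x, w, hxB, hxw, hwA⟩ : ∃ x w, x ∈ L.B (n + 2) ∧ G.Adj x w ∧ w ∈ L.A (n + 2) := by
    rcases S_succ_eq_A_or_eq_B hG hSt hC with h | h
    · obtain ⟨y, hy⟩ := L.nonempty_B (n + 3)
      obtain ⟨x, hyx, hx⟩ := L.B_adj _ y hy
      exact ⟨x, y, hx, hyx.symm, h ▸ B_subset_S hG hy⟩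
    · obtain ⟨x, hx⟩ := L.nonempty_A (n + 3)
      obtain ⟨w, hxw, hw⟩ := L.A_adj _ x hx
      exact ⟨x, w, h ▸ A_subset_S hG hx, hxw, hw⟩
  have hxA : x ∈ L.A (n + 1) := hA ▸ B_subset_S hG hxB
  have hwA' : w ∈ L.A (n + 1) := hA ▸ A_subset_S hG hwA
  obtain ⟨u, hxu, hu⟩ := L.B_adj _ x hxB
  obtain ⟨v, hxv, hv⟩ := L.A_adj _ x hxA
  have hxw' : ¬ BallEquiv G φ (n + 2) x w := fun h => not_equiv_of_mem_A_of_mem_B hwA hxB h.symm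
  have hBA : ∀ {s}, s ∈ L.A (n + 1) → ¬ BallEquiv G φ (n + 2) s u := fun hs h =>
    not_equiv_of_mem_A_of_mem_B hs hu (h.mono hG (Nat.le_succ _))
  have hSA : ∀ {s}, s ∈ L.S n → ¬ BallEquiv G φ (n + 2) s v := fun hs h =>
    hdisj hv ((mem_S_iff hs).2 (h.mono hG (by omega)))
  have hwS := A_subset_S hG hwA'
  have huS := B_subset_S hG hu
  refine hbr x ⟨![w, u, v], ?_, ?_, ?_⟩
  · simp [Fin.forall_fin_succ, hxw, hxu, hxv]
  · simp [Fin.forall_fin_succ, hxw', hBA hxA, hSA (A_subset_S hG hxA)]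
  · have hsymm : ∀ {s t}, ¬ BallEquiv G φ (n + 2) s t → ¬ BallEquiv G φ (n + 2) t s :=
      fun h h' => h h'.symm
    simp [Fin.forall_fin_succ, hBA hwA', hsymm (hBA hwA'), hSA hwS, hsymm (hSA hwS), hSA huS,
      hsymm (hSA huS)]

theorem S_eq_A_and_S_eq_C_of_succ (hG : G.Connected) (hSt : IsSturmian G φ) (hab : a ≠ b)
    (L : Labeling G φ a b) (hfin : ∀ v, (G.neighborSet v).Finite)
    (h : L.S (n + 1) = L.A (n + 1) ∧ L.S (n + 1) = L.C (n + 1)) :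
    L.S n = L.A n ∧ L.S n = L.C n :=
  ⟨S_eq_A_of_succ hG hSt (not_isBranch hG hSt hab L hfin _) h.1 h.2,
    S_eq_C_of_S_succ_subset (h.1 ▸ A_subset_S hG)⟩

end Labeling

end Lemmas


/-- Lemma 2.5: there exists `K ∈ [0, ∞]` such that
`S_n = A_n = C_n` if and only if `n < K`; if `K` is finite then `A_K = S_K` or
`B_K = S_K`. -/
theorem exists_K {V α : Type} (G : SimpleGraph V) (d : ℕ) (hd : 3 ≤ d)
    (hT : IsRegularTree G d) (φ : V → α) (hSt : IsSturmian G φ)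
    (a b : α) (hab : a ≠ b) (L : Labeling G φ a b) :
    ∃ K : ℕ∞, (∀ n : ℕ, (L.S n = L.A n ∧ L.S n = L.C n) ↔ (n : ℕ∞) < K) ∧
      (∀ k : ℕ, K = (k : ℕ∞) → L.A k = L.S k ∨ L.B k = L.S k) := by
  have hG := hT.isTree.connected
  have hfin : ∀ v, (G.neighborSet v).Finite := fun v =>
    Set.finite_of_ncard_ne_zero (by rw [hT.regular]; omega)
  have hanti : ∀ {m n}, m ≤ n → L.S n = L.A n ∧ L.S n = L.C n → L.S m = L.A m ∧ L.S m = L.C m := by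
    intro m n hmn h
    induction n, hmn using Nat.le_induction with
    | base => exact h
    | succ n _ ih => exact ih (Labeling.S_eq_A_and_S_eq_C_of_succ hG hSt hab L hfin h)
  by_cases hall : ∀ n, L.S n = L.A n ∧ L.S n = L.C n
  · exact ⟨⊤, fun n => ⟨fun _ => ENat.natCast_lt_top n, fun _ => hall n⟩,
      fun k hk => (ENat.natCast_ne_top k hk.symm).elim⟩
  · push Not at hall
    have hex : ∃ n, ¬ (L.S n = L.A n ∧ L.S n = L.C n) := by simpa using hall
    refine ⟨(Nat.find hex : ℕ), fun n => ?_, fun k hk => ?_⟩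
    · rw [Nat.cast_lt]
      exact ⟨fun h => not_le.1 fun hle => Nat.find_spec hex (hanti hle h),
        fun h => not_not.1 (Nat.find_min hex h)⟩
    · rw [Nat.cast_inj] at hk
      cases k with
      | zero => exact Or.inl L.A0_eq_S0
      | succ k =>
        have hk' := not_not.1 (Nat.find_min hex (m := k) (by omega))
        exact (Labeling.S_succ_eq_A_or_eq_B hG hSt hk'.2).imp Eq.symm Eq.symm

end Sturm
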